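/- Let H be a group, Δ a finite H-labelled digraph, and v₀, v₁ vertices of Δ. For every path p in Δ from v₀ to v₁ there exist r ≥ 0, lollipop loops γ₁, …, γ_r based at v₀, and a simple path q from v₀ to v₁, such that π(Lab p) = π(Lab γ₁)·π(Lab γ₂)⋯π(Lab γ_r)·π(Lab q) in H. -/

import Mathlib

/-- An `H`-labelled digraph: a finite vertex set, a finite edge set, each edge `e`
having an initial vertex `o e`, a terminal vertex `t e` and a label `lab e ∈ H`,
together with an involution `e ↦ inv e` with `o (inv e) = t e`, `t (inv e) = o e`
and `lab (inv e) = (lab e)⁻¹`. -/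
structure LabelledDigraph (H : Type*) [Group H] where
  V : Type
  E : Type
  [fintypeV : Fintype V]
  [fintypeE : Fintype E]
  o : E → V
  t : E → V
  lab : E → H
  inv : E → E
  inv_inv : ∀ e, inv (inv e) = e
  o_inv : ∀ e, o (inv e) = t e
  t_inv : ∀ e, t (inv e) = o e
  lab_inv : ∀ e, lab (inv e) = (lab e)⁻¹

namespace LabelledDigraph

attribute [instance] fintypeV fintypeE

variable {H : Type*} [Group H]

/-- `IsPath Δ v₀ v₁ p` : the list of edges `p = e₁ ⋯ e_n` is a path in `Δ` from `v₀`
to `v₁`, i.e. `o e₁ = v₀`, `t e_n = v₁` and `o e_{i+1} = t e_i` (the empty path at a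
vertex is a path from that vertex to itself). -/
inductive IsPath (Δ : LabelledDigraph H) : Δ.V → Δ.V → List Δ.E → Prop
  | nil (v : Δ.V) : IsPath Δ v v []
  | cons (e : Δ.E) {v : Δ.V} {p : List Δ.E} :
      IsPath Δ (Δ.t e) v p → IsPath Δ (Δ.o e) v (e :: p)

/-- `π(Lab p)`, the product in `H` of the labels of the edges of `p`
(the empty path has label `1`). -/
def pathLabel (Δ : LabelledDigraph H) (p : List Δ.E) : H :=
  (p.map Δ.lab).prod

/-- A simple path from `v₀` to `v₁`: a path whose vertex sequence
`v₀, t e₁, …, t e_n` visits no vertex twice. -/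
def IsSimplePath (Δ : LabelledDigraph H) (v₀ v₁ : Δ.V) (p : List Δ.E) : Prop :=
  Δ.IsPath v₀ v₁ p ∧ (v₀ :: p.map Δ.t).Nodup

/-- A simple loop at `v`: a nonempty closed path at `v` visiting no vertex twice
except that it begins and ends at `v`. -/
def IsSimpleLoop (Δ : LabelledDigraph H) (v : Δ.V) (p : List Δ.E) : Prop :=
  p ≠ [] ∧ Δ.IsPath v v p ∧ (p.map Δ.t).Nodup

/-- A lollipop loop at `v`: a path of the form `q ℓ q⁻¹` where `q` is a simple path
from `v` to some vertex `v'` and `ℓ` is a simple loop at `v'`. -/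
def IsLollipop (Δ : LabelledDigraph H) (v : Δ.V) (p : List Δ.E) : Prop :=
  ∃ (v' : Δ.V) (q ℓ : List Δ.E), Δ.IsSimplePath v v' q ∧ Δ.IsSimpleLoop v' ℓ ∧
    p = q ++ ℓ ++ (q.reverse.map Δ.inv)

end LabelledDigraph

namespace LabelledDigraph

variable {H : Type*} [Group H] {Δ : LabelledDigraph H}

theorem isPath_nil_iff {u v : Δ.V} : Δ.IsPath u v [] ↔ u = v := by
  constructor
  · rintro ⟨⟩
    rfl
  · rintro rfl
    exact .nil u

theorem isPath_cons_iff {u v : Δ.V} {e : Δ.E} {p : List Δ.E} :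
    Δ.IsPath u v (e :: p) ↔ Δ.o e = u ∧ Δ.IsPath (Δ.t e) v p := by
  constructor
  · rintro ⟨⟩
    exact ⟨rfl, ‹_›⟩
  · rintro ⟨rfl, h⟩
    exact .cons e h

theorem isPath_append_iff {u w : Δ.V} {p q : List Δ.E} :
    Δ.IsPath u w (p ++ q) ↔ ∃ v, Δ.IsPath u v p ∧ Δ.IsPath v w q := by
  induction p generalizing u with
  | nil => simp [isPath_nil_iff]
  | cons e p ih => simp [isPath_cons_iff, ih, and_assoc]

theorem isPath_singleton_iff {u v : Δ.V} {e : Δ.E} :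
    Δ.IsPath u v [e] ↔ Δ.o e = u ∧ Δ.t e = v := by
  rw [isPath_cons_iff, isPath_nil_iff]

theorem IsPath.end_mem {u v : Δ.V} {p : List Δ.E} (h : Δ.IsPath u v p) :
    v ∈ u :: p.map Δ.t := by
  induction h with
  | nil v => simp
  | cons e _ ih => exact List.mem_cons_of_mem _ ih

theorem IsPath.exists_append_of_mem {u v w : Δ.V} {p : List Δ.E} (h : Δ.IsPath u v p)
    (hw : w ∈ u :: p.map Δ.t) :
    ∃ p₁ p₂, p = p₁ ++ p₂ ∧ Δ.IsPath u w p₁ ∧ Δ.IsPath w v p₂ := by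
  induction h with
  | nil v =>
    obtain rfl : w = v := by simpa using hw
    exact ⟨[], [], rfl, .nil w, .nil w⟩
  | cons e hp ih =>
    rcases List.mem_cons.1 hw with rfl | hw
    · exact ⟨[], _, rfl, .nil _, .cons e hp⟩
    · obtain ⟨p₁, p₂, rfl, h₁, h₂⟩ := ih hw
      exact ⟨e :: p₁, p₂, rfl, .cons e h₁, h₂⟩

theorem pathLabel_append (p q : List Δ.E) :
    Δ.pathLabel (p ++ q) = Δ.pathLabel p * Δ.pathLabel q := by
  simp [pathLabel]

theorem pathLabel_reverse_map_inv (p : List Δ.E) :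
    Δ.pathLabel (p.reverse.map Δ.inv) = (Δ.pathLabel p)⁻¹ := by
  simp [pathLabel, List.prod_inv_reverse, Function.comp_def, Δ.lab_inv]

end LabelledDigraph

/-- Let `H` be a group, `Δ` a finite `H`-labelled digraph, and
`v₀, v₁` vertices of `Δ`. For every path `p` in `Δ` from `v₀` to `v₁` there exist
`r ≥ 0`, lollipop loops `γ₁, …, γ_r` based at `v₀`, and a simple path `q` from `v₀`
to `v₁`, such that `π(Lab p) = π(Lab γ₁)·π(Lab γ₂)⋯π(Lab γ_r)·π(Lab q)` in `H`. -/
theorem stmt_2 {H : Type*} [Group H] (Δ : LabelledDigraph H) (v₀ v₁ : Δ.V)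
    (p : List Δ.E) (hp : Δ.IsPath v₀ v₁ p) :
    ∃ (L : List (List Δ.E)) (q : List Δ.E),
      (∀ γ ∈ L, Δ.IsLollipop v₀ γ) ∧
      Δ.IsSimplePath v₀ v₁ q ∧
      Δ.pathLabel p = (L.map Δ.pathLabel).prod * Δ.pathLabel q := by
  open LabelledDigraph in
  induction p using List.reverseRecOn generalizing v₁ with
  | nil =>
    obtain rfl := isPath_nil_iff.1 hp
    exact ⟨[], [], by simp, ⟨.nil _, by simp⟩, by simp⟩
  | append_singleton p e ih =>
    obtain ⟨u, hp, he⟩ := isPath_append_iff.1 hp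
    obtain ⟨L, q, hL, ⟨hq, hnd⟩, hlab⟩ := ih u hp
    obtain ⟨rfl, rfl⟩ := isPath_singleton_iff.1 he
    by_cases hmem : Δ.t e ∈ v₀ :: q.map Δ.t
    · obtain ⟨q₁, q₂, rfl, h₁, h₂⟩ := hq.exists_append_of_mem hmem
      rw [List.map_append, ← List.cons_append, List.nodup_append'] at hnd
      obtain ⟨hnd₁, hnd₂, hdisj⟩ := hnd
      have hs : Δ.IsSimplePath v₀ (Δ.t e) q₁ := ⟨h₁, hnd₁⟩
      refine ⟨L ++ [q₁ ++ (q₂ ++ [e]) ++ q₁.reverse.map Δ.inv], q₁, ?_, hs, ?_⟩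
      · intro γ hγ
        rcases List.mem_append.1 hγ with hγ | hγ
        · exact hL γ hγ
        · refine ⟨Δ.t e, q₁, q₂ ++ [e], hs, ⟨by simp, isPath_append_iff.2 ⟨_, h₂, he⟩, ?_⟩,
            List.mem_singleton.1 hγ⟩
          rw [List.map_append, List.map_singleton, ← List.concat_eq_append]
          exact hnd₂.concat (hdisj h₁.end_mem)
      · simp only [pathLabel_append, pathLabel_reverse_map_inv, hlab, List.map_append,
          List.map_singleton, List.prod_append, List.prod_singleton, mul_assoc,
          inv_mul_cancel, mul_one]
    · refine ⟨L, q ++ [e], hL, ⟨isPath_append_iff.2 ⟨_, hq, he⟩, ?_⟩, ?_⟩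
      · rw [List.map_append, List.map_singleton, ← List.cons_append, ← List.concat_eq_append]
        exact hnd.concat hmem
      · rw [pathLabel_append, hlab, pathLabel_append, mul_assoc]
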